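/- arXiv:2512.16330 — 3 statements merged into one kernel-verified Lean document; each statement's English description precedes it below -/
import Mathlib

section
/- Let ψ : ℕ → List ℕ be a bijection such that ψ(n) being a prefix of ψ(m) implies n ≤ m, and let ≪ be the relation on ℕ generated by: 0 ≪ n for all n > 0; 2m ≪ 2n iff m < n; (2m+1) ≪ (2n+1) iff ψ(m+1) is a prefix of ψ(n+1) and m ≠ n; and no other relations. Then ≪ is a tree ordering on ℕ with 0 as its least element: 0 ≪ n for every n > 0, and for every n ∈ ℕ the set of ≪-predecessors of n is linearly ordered by ≪. -/
/-- The Martin–Steel tree relation `≪` on `ℕ`, determined by a bijection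
`ψ : ℕ → List ℕ`: (1) `0 ≪ n` for all `n > 0`; (2) `2m ≪ 2n` iff `m < n`;
(3) `2m+1 ≪ 2n+1` iff `ψ(m+1)` is a prefix of `ψ(n+1)` and `m ≠ n`;
and no pair is related unless forced by (1)–(3). -/
def MSRel (ψ : ℕ → List ℕ) (m n : ℕ) : Prop :=
  (m = 0 ∧ 0 < n) ∨
  (∃ a b : ℕ, m = 2 * a ∧ n = 2 * b ∧ a < b) ∨
  (∃ a b : ℕ, m = 2 * a + 1 ∧ n = 2 * b + 1 ∧ ψ (a + 1) <+: ψ (b + 1) ∧ a ≠ b)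

/-- `≪` is a tree ordering on ℕ with 0 as its least element: it is a
strict partial order, `0 ≪ n` for every `n > 0`, and for every `n` the set of
`≪`-predecessors of `n` is linearly ordered by `≪`. -/
theorem MSRel_tree_ordering (ψ : ℕ → List ℕ)
    (hbij : Function.Bijective ψ)
    (hmono : ∀ m n : ℕ, ψ n <+: ψ m → n ≤ m) :
    (∀ n : ℕ, ¬ MSRel ψ n n) ∧
    (∀ a b c : ℕ, MSRel ψ a b → MSRel ψ b c → MSRel ψ a c) ∧
    (∀ n : ℕ, 0 < n → MSRel ψ 0 n) ∧
    (∀ n a b : ℕ, MSRel ψ a n → MSRel ψ b n →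
      a = b ∨ MSRel ψ a b ∨ MSRel ψ b a) := by
  refine ⟨?_, ?_, ?_, ?_⟩
  · rintro n (⟨h1, h2⟩ | ⟨a, b, h1, h2, h3⟩ | ⟨a, b, h1, h2, h3, h4⟩) <;> omega
  · rintro a b c (⟨h1, h2⟩ | ⟨x, y, h1, h2, h3⟩ | ⟨x, y, h1, h2, h3, h4⟩)
      (⟨k1, k2⟩ | ⟨z, w, k1, k2, k3⟩ | ⟨z, w, k1, k2, k3, k4⟩)
    · omega
    · exact Or.inl ⟨h1, by omega⟩
    · exact Or.inl ⟨h1, by omega⟩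
    · omega
    · exact Or.inr (Or.inl ⟨x, w, h1, k2, by omega⟩)
    · omega
    · omega
    · omega
    · obtain rfl : y = z := by omega
      refine Or.inr (Or.inr ⟨x, w, h1, k2, h3.trans k3, ?_⟩)
      rintro rfl
      have e1 := hmono _ _ h3
      have e2 := hmono _ _ k3
      omega
  · intro n hn
    exact Or.inl ⟨rfl, hn⟩
  · intro n a b ha hb
    rcases Nat.eq_zero_or_pos a with ha0 | ha0
    · rcases Nat.eq_zero_or_pos b with hb0 | hb0
      · left; omega
      · exact Or.inr (Or.inl (Or.inl ⟨ha0, hb0⟩))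
    rcases Nat.eq_zero_or_pos b with hb0 | hb0
    · exact Or.inr (Or.inr (Or.inl ⟨hb0, ha0⟩))
    rcases ha with ⟨h1, h2⟩ | ⟨x, y, h1, h2, h3⟩ | ⟨x, y, h1, h2, h3, h4⟩
    · omega
    · rcases hb with ⟨k1, k2⟩ | ⟨z, w, k1, k2, k3⟩ | ⟨z, w, k1, k2, k3, k4⟩
      · omega
      · rcases lt_trichotomy x z with h | h | h
        · exact Or.inr (Or.inl (Or.inr (Or.inl ⟨x, z, h1, k1, h⟩)))
        · left; omega
        · exact Or.inr (Or.inr (Or.inr (Or.inl ⟨z, x, k1, h1, h⟩)))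
      · omega
    · rcases hb with ⟨k1, k2⟩ | ⟨z, w, k1, k2, k3⟩ | ⟨z, w, k1, k2, k3, k4⟩
      · omega
      · omega
      · obtain rfl : y = w := by omega
        by_cases hxz : x = z
        · left; omega
        · rcases List.prefix_or_prefix_of_prefix h3 k3 with h | h
          · exact Or.inr (Or.inl (Or.inr (Or.inr ⟨x, z, h1, k1, h, hxz⟩)))
          · exact Or.inr (Or.inr (Or.inr (Or.inr ⟨z, x, k1, h1, h, Ne.symm hxz⟩)))
end

section
/- Let ψ : ℕ → List ℕ be a bijection such that ψ(n) being a prefix of ψ(m) implies n ≤ m, and let ≪ be the relation on ℕ generated by: 0 ≪ n for all n > 0; 2m ≪ 2n iff m < n; (2m+1) ≪ (2n+1) iff ψ(m+1) is a prefix of ψ(n+1) and m ≠ n; and no other relations. For each function x : ℕ → ℕ, let B_x := {0} ∪ {2n+1 : ψ(n+1) is an initial segment of x, i.e., ψ(n+1) = [x(0), …, x(k−1)] for some k}. Then B_x is an infinite branch of ⟨ℕ, ≪⟩ (an infinite maximal ≪-linearly-ordered subset), and the assignment x ↦ B_x is injective. -/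
/-- The "odd branch" determined by `x : ℕ → ℕ`:
`B_x = {0} ∪ {2n+1 : ψ(n+1) = [x(0), …, x(k−1)] for some k}`. -/
def MSOddBranch (ψ : ℕ → List ℕ) (x : ℕ → ℕ) : Set ℕ :=
  {0} ∪ {m : ℕ | ∃ n k : ℕ, m = 2 * n + 1 ∧ ψ (n + 1) = (List.range k).map x}

theorem ms_prefix_take (x : ℕ → ℕ) {j k : ℕ} (h : j ≤ k) :
    (List.range j).map x <+: (List.range k).map x := by
  apply List.IsPrefix.map
  obtain ⟨d, rfl⟩ := Nat.exists_eq_add_of_le h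
  rw [List.range_add]
  exact List.prefix_append _ _

theorem ms_exists (ψ : ℕ → List ℕ) (hbij : Function.Bijective ψ)
    (hmono : ∀ m n : ℕ, ψ n <+: ψ m → n ≤ m) (x : ℕ → ℕ) (k : ℕ) :
    ∃ n, ψ (n + 1) = (List.range (k + 1)).map x := by
  have h0 : ψ 0 = [] := by
    obtain ⟨n, hn⟩ := hbij.2 []
    have : n ≤ 0 := hmono 0 n (by rw [hn]; exact List.nil_prefix)
    obtain rfl : n = 0 := by omega
    exact hn
  obtain ⟨n, hn⟩ := hbij.2 ((List.range (k + 1)).map x)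
  cases n with
  | zero =>
    rw [h0] at hn
    have := congrArg List.length hn
    simp at this
  | succ n => exact ⟨n, hn⟩

/-- For each `x : ℕ → ℕ`, `B_x` is an infinite branch of `⟨ℕ, ≪⟩`
(an infinite maximal `≪`-linearly-ordered subset), and `x ↦ B_x` is injective. -/
theorem odd_branches (ψ : ℕ → List ℕ)
    (hbij : Function.Bijective ψ)
    (hmono : ∀ m n : ℕ, ψ n <+: ψ m → n ≤ m) :
    (∀ x : ℕ → ℕ, IsMaxChain (MSRel ψ) (MSOddBranch ψ x) ∧
      (MSOddBranch ψ x).Infinite) ∧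
    Function.Injective (MSOddBranch ψ) := by
  choose f hf using ms_exists ψ hbij hmono
  have hmem : ∀ x k, 2 * f x k + 1 ∈ MSOddBranch ψ x :=
    fun x k => Or.inr ⟨f x k, k + 1, rfl, hf x k⟩
  refine ⟨fun x => ⟨⟨?_, ?_⟩, ?_⟩, ?_⟩
  · rintro a (ha | ⟨n, k, rfl, hk⟩) b (hb | ⟨m, l, rfl, hl⟩) hab
    · exact absurd (ha.trans hb.symm) hab
    · exact Or.inl (Or.inl ⟨ha, by omega⟩)
    · exact Or.inr (Or.inl ⟨hb, by omega⟩)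
    · have hne : n ≠ m := fun h => hab (by rw [h])
      rcases le_total k l with h | h
      · exact Or.inl (Or.inr (Or.inr ⟨n, m, rfl, rfl,
          by rw [hk, hl]; exact ms_prefix_take x h, hne⟩))
      · exact Or.inr (Or.inr (Or.inr ⟨m, n, rfl, rfl,
          by rw [hk, hl]; exact ms_prefix_take x h, hne.symm⟩))
  · intro t ht hst
    refine Set.Subset.antisymm hst fun m hm => ?_
    by_contra hmB
    have hm0 : m ≠ 0 := fun h => hmB (Or.inl h)
    have key : ∀ k, MSRel ψ m (2 * f x k + 1) ∨ MSRel ψ (2 * f x k + 1) m := fun k =>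
      ht hm (hst (hmem x k)) (fun h => hmB (h ▸ hmem x k))
    rcases Nat.even_or_odd' m with ⟨a, rfl | rfl⟩
    · rcases key 0 with (h | ⟨c, d, h1, h2, h3⟩ | ⟨c, d, h1, h2, h3⟩) |
        (h | ⟨c, d, h1, h2, h3⟩ | ⟨c, d, h1, h2, h3⟩) <;> omega
    · rcases key (ψ (a + 1)).length with (h | ⟨c, d, h1, h2, h3⟩ | ⟨c, d, h1, h2, h3, h4⟩) |
        (h | ⟨c, d, h1, h2, h3⟩ | ⟨c, d, h1, h2, h3, h4⟩)
      · omega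
      · omega
      · obtain rfl : a = c := by omega
        obtain rfl : f x (ψ (a + 1)).length = d := by omega
        rw [hf] at h3
        refine hmB (Or.inr ⟨a, (ψ (a + 1)).length, rfl, ?_⟩)
        have h5 := ms_prefix_take x (Nat.le_succ (ψ (a + 1)).length)
        exact (List.prefix_of_prefix_length_le h3 h5 (by simp)).eq_of_length (by simp)
      · omega
      · omega
      · obtain rfl : a = d := by omega
        obtain rfl : f x (ψ (a + 1)).length = c := by omega
        rw [hf] at h3
        have := h3.length_le
        simp at this
  · refine Set.infinite_of_injective_forall_mem (f := fun k => 2 * f x k + 1) ?_ (hmem x)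
    intro i j hij
    have h : f x i = f x j := by
      simp only at hij
      omega
    have h2 := hf x i
    rw [h, hf x j] at h2
    have := congrArg List.length h2
    simp at this
    omega
  · intro x y hxy
    funext k
    have h := hmem x k
    rw [hxy] at h
    rcases h with h | ⟨n, l, h1, h2⟩
    · exact absurd h (Nat.succ_ne_zero _)
    · obtain rfl : f x k = n := by omega
      rw [hf] at h2
      have hl := congrArg List.length h2
      simp only [List.length_map, List.length_range] at hl
      subst hl
      exact List.map_inj_left.1 h2 k (by simp)
end

section
/- Let ψ : ℕ → List ℕ be a bijection such that ψ(n) being a prefix of ψ(m) implies n ≤ m, and let ≪ be the relation on ℕ generated by: 0 ≪ n for all n > 0; 2m ≪ 2n iff m < n; (2m+1) ≪ (2n+1) iff ψ(m+1) is a prefix of ψ(n+1) and m ≠ n; and no other relations. Then every infinite branch of ⟨ℕ, ≪⟩ is either the set E of even natural numbers, or is equal to B_x := {0} ∪ {2n+1 : ψ(n+1) = [x(0), …, x(k−1)] for some k} for a unique function x : ℕ → ℕ. -/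
theorem MS_odd_odd {ψ : ℕ → List ℕ} {b : Set ℕ} (hc : IsChain (MSRel ψ) b) {a c : ℕ}
    (ha : 2 * a + 1 ∈ b) (hcb : 2 * c + 1 ∈ b) :
    ψ (a + 1) <+: ψ (c + 1) ∨ ψ (c + 1) <+: ψ (a + 1) := by
  by_cases h : a = c
  · subst h; exact Or.inl (List.prefix_refl _)
  · have key : ∀ u v, MSRel ψ (2 * u + 1) (2 * v + 1) → ψ (u + 1) <+: ψ (v + 1) := by
      rintro u v (⟨h1, _⟩ | ⟨p, q, h1, h2, _⟩ | ⟨p, q, h1, h2, h3, _⟩)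
      · omega
      · omega
      · obtain rfl : u = p := by omega
        obtain rfl : v = q := by omega
        exact h3
    rcases hc ha hcb (by omega) with h1 | h1
    · exact Or.inl (key _ _ h1)
    · exact Or.inr (key _ _ h1)

theorem MS_even_odd {ψ : ℕ → List ℕ} {b : Set ℕ} (hc : IsChain (MSRel ψ) b) {a c : ℕ}
    (ha : 2 * a + 1 ∈ b) (hcb : 2 * c ∈ b) : c = 0 := by
  rcases hc ha hcb (by omega) with
    (⟨h1, _⟩ | ⟨p, q, h1, h2, _⟩ | ⟨p, q, h1, h2, h3, _⟩) |
    (⟨h1, _⟩ | ⟨p, q, h1, h2, _⟩ | ⟨p, q, h1, h2, h3, _⟩) <;> omega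

theorem MS_range_prefix (x : ℕ → ℕ) {k l : ℕ} (h : k ≤ l) :
    (List.range k).map x <+: (List.range l).map x := by
  obtain ⟨d, rfl⟩ := Nat.exists_eq_add_of_le h
  rw [List.range_add, List.map_append]
  exact List.prefix_append _ _

theorem MS_oddBranch_chain (ψ : ℕ → List ℕ) (x : ℕ → ℕ) :
    IsChain (MSRel ψ) (MSOddBranch ψ x) := by
  rintro u hu v hv huv
  rcases hu with hu | ⟨n, k, rfl, hn⟩
  · have : u = 0 := hu
    exact Or.inl (Or.inl ⟨this, by omega⟩)
  · rcases hv with hv | ⟨m, l, rfl, hm⟩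
    · have : v = 0 := hv
      exact Or.inr (Or.inl ⟨this, by omega⟩)
    · rcases le_total k l with h | h
      · refine Or.inl (Or.inr (Or.inr ⟨n, m, rfl, rfl, ?_, by omega⟩))
        rw [hn, hm]; exact MS_range_prefix x h
      · refine Or.inr (Or.inr (Or.inr ⟨m, n, rfl, rfl, ?_, by omega⟩))
        rw [hn, hm]; exact MS_range_prefix x h

theorem MS_even_chain (ψ : ℕ → List ℕ) : IsChain (MSRel ψ) {n : ℕ | Even n} := by
  rintro u ⟨a, rfl⟩ v ⟨c, rfl⟩ huv
  rcases lt_or_ge a c with h | h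
  · exact Or.inl (Or.inr (Or.inl ⟨a, c, by omega, by omega, h⟩))
  · exact Or.inr (Or.inr (Or.inl ⟨c, a, by omega, by omega, by omega⟩))

theorem MS_oddBranch_inj (ψ : ℕ → List ℕ) (hs : Function.Surjective ψ) (h0 : ψ 0 = [])
    {x y : ℕ → ℕ} (h : MSOddBranch ψ x = MSOddBranch ψ y) : x = y := by
  funext k
  obtain ⟨n, hn⟩ := hs ((List.range (k + 1)).map x)
  obtain _ | n := n
  · have := congrArg List.length hn
    simp [h0] at this
  · have hm : 2 * n + 1 ∈ MSOddBranch ψ y := by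
      rw [← h]; exact Or.inr ⟨n, k + 1, rfl, hn⟩
    rcases hm with hm | ⟨m, l, hm, hl⟩
    · have : 2 * n + 1 = 0 := hm
      omega
    · obtain rfl : n = m := by omega
      rw [hn] at hl
      have hlen := congrArg List.length hl
      simp only [List.length_map, List.length_range] at hlen
      subst hlen
      have := List.map_inj_left.1 hl k (by simp)
      exact this

/-- Every infinite branch of `⟨ℕ, ≪⟩` (infinite maximal
`≪`-linearly-ordered subset) is either the set of even natural numbers, or is
equal to `B_x` for a unique `x : ℕ → ℕ`. -/
theorem branch_classification (ψ : ℕ → List ℕ)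
    (hbij : Function.Bijective ψ)
    (hmono : ∀ m n : ℕ, ψ n <+: ψ m → n ≤ m)
    (b : Set ℕ) (hmax : IsMaxChain (MSRel ψ) b) (hinf : b.Infinite) :
    b = {n : ℕ | Even n} ∨ ∃! x : ℕ → ℕ, b = MSOddBranch ψ x := by
  have h0 : ψ 0 = [] := by
    obtain ⟨n, hn⟩ := hbij.2 []
    have := hmono 0 n (by rw [hn]; exact List.nil_prefix)
    obtain rfl : n = 0 := by omega
    exact hn
  have hc := hmax.1
  by_cases hodd : ∃ a, 2 * a + 1 ∈ b
  · right
    obtain ⟨a, ha⟩ := hodd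
    have hlong : ∀ k, ∃ n, 2 * n + 1 ∈ b ∧ k < (ψ (n + 1)).length := by
      intro k
      by_contra! hcon
      apply hinf
      have hfin : (Set.image (fun m => (ψ ((m - 1) / 2 + 1)).length) (b \ {0})).Finite := by
        apply (Set.finite_Iic k).subset
        rintro _ ⟨m, ⟨hm, hm0⟩, rfl⟩
        rcases Nat.even_or_odd' m with ⟨c, rfl | rfl⟩
        · have := MS_even_odd hc ha hm
          subst this
          exact absurd rfl hm0
        · have := hcon c hm
          have e : (2 * c + 1 - 1) / 2 = c := by omega
          simpa [e] using this
      have hinj : Set.InjOn (fun m => (ψ ((m - 1) / 2 + 1)).length) (b \ {0}) := by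
        rintro u ⟨hu, hu0⟩ v ⟨hv, hv0⟩ huv
        have ou : ∀ w ∈ b, w ∉ ({0} : Set ℕ) → ∃ c, w = 2 * c + 1 := by
          intro w hw hw0
          rcases Nat.even_or_odd' w with ⟨c, rfl | rfl⟩
          · have := MS_even_odd hc ha hw
            subst this
            exact absurd rfl hw0
          · exact ⟨c, rfl⟩
        obtain ⟨c, rfl⟩ := ou u hu hu0
        obtain ⟨d, rfl⟩ := ou v hv hv0
        have e : (2 * c + 1 - 1) / 2 = c := by omega
        have e2 : (2 * d + 1 - 1) / 2 = d := by omega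
        simp only [e, e2] at huv
        have : ψ (c + 1) = ψ (d + 1) := by
          rcases MS_odd_odd hc hu hv with h | h
          · exact h.eq_of_length huv
          · exact (h.eq_of_length huv.symm).symm
        have := hbij.1 this
        omega
      have := Set.Finite.of_finite_image hfin hinj
      exact (this.insert 0).subset (by
        intro m hm
        by_cases h : m = 0
        · exact Or.inl h
        · exact Or.inr ⟨hm, h⟩)
    choose f hf hlen using hlong
    have hsub : b ⊆ MSOddBranch ψ (fun k => (ψ (f k + 1)).get ⟨k, hlen k⟩) := by
      intro m hm
      rcases Nat.even_or_odd' m with ⟨c, rfl | rfl⟩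
      · have := MS_even_odd hc ha hm
        subst this
        exact Or.inl rfl
      · refine Or.inr ⟨c, (ψ (c + 1)).length, rfl, ?_⟩
        apply List.ext_getElem
        · simp
        · intro i h1 h2
          simp only [List.getElem_map, List.getElem_range, List.get_eq_getElem]
          rcases MS_odd_odd hc hm (hf i) with h | h
          · exact h.getElem h1
          · exact (h.getElem (hlen i)).symm
    have heq := hmax.2 (MS_oddBranch_chain ψ _) hsub
    refine ⟨_, heq, ?_⟩
    intro y hy
    exact MS_oddBranch_inj ψ hbij.2 h0 (hy.symm.trans heq)
  · left
    apply hmax.2 (MS_even_chain ψ)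
    intro m hm
    rcases Nat.even_or_odd' m with ⟨c, rfl | rfl⟩
    · exact ⟨c, by omega⟩
    · exact absurd ⟨c, hm⟩ hodd
end
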